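/- arXiv:1106.0456 — 2 statements merged into one kernel-verified Lean document; each statement's English description precedes it below -/
import Mathlib

section
/- For 1 < p < ∞, the constant p/(p-1) in the Hardy inequality ‖Hf‖_{L^p(ℝ)} ≤ (p/(p-1))‖f‖_{L^p(ℝ)} is sharp: the operator norm of H on L^p(0,∞) equals p/(p-1). -/
open MeasureTheory

/-- The one-dimensional Hardy operator `Hf(x) = (1/x) ∫₀ˣ f(t) dt`. -/
noncomputable def hardyOp1 (f : ℝ → ℝ) (x : ℝ) : ℝ :=
  x⁻¹ * ∫ t in (0:ℝ)..x, f t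

theorem enorm_hardyOp1_le (f : ℝ → ℝ) {x : ℝ} (hx : 0 < x) :
    ‖hardyOp1 f x‖ₑ ≤ ENNReal.ofReal x⁻¹ * ∫⁻ t in Set.Ioc 0 x, ‖f t‖ₑ := by
  rw [hardyOp1, enorm_mul, Real.enorm_of_nonneg (inv_nonneg.2 hx.le),
    intervalIntegral.integral_of_le hx.le]
  gcongr
  exact enorm_integral_le_lintegral_enorm _

theorem lintegral_Ioc_zero_rpow {s x : ℝ} (hs : -1 < s) (hx : 0 < x) :
    ∫⁻ t in Set.Ioc 0 x, ENNReal.ofReal (t ^ s) = ENNReal.ofReal (x ^ (s + 1) / (s + 1)) := by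
  have hint := intervalIntegral.intervalIntegrable_rpow' (a := 0) (b := x) hs
  rw [intervalIntegrable_iff_integrableOn_Ioc_of_le hx.le] at hint
  rw [← ofReal_integral_eq_lintegral_ofReal hint, ← intervalIntegral.integral_of_le hx.le,
    integral_rpow (Or.inl hs), Real.zero_rpow (by linarith), sub_zero]
  filter_upwards [ae_restrict_mem measurableSet_Ioc] with t ht
  exact Real.rpow_nonneg ht.1.le _

theorem lintegral_Ioi_rpow {s t : ℝ} (hs : s < -1) (ht : 0 < t) :
    ∫⁻ x in Set.Ioi t, ENNReal.ofReal (x ^ s) = ENNReal.ofReal (-t ^ (s + 1) / (s + 1)) := by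
  rw [← ofReal_integral_eq_lintegral_ofReal (integrableOn_Ioi_rpow_of_lt hs ht),
    integral_Ioi_rpow_of_lt hs ht]
  filter_upwards [ae_restrict_mem measurableSet_Ioi] with x hx
  exact Real.rpow_nonneg (ht.trans hx).le _

theorem lintegral_mul_lintegral_Ioc_swap {c g : ℝ → ENNReal} (hc : Measurable c)
    (hg : Measurable g) :
    ∫⁻ x in Set.Ioi (0 : ℝ), c x * ∫⁻ t in Set.Ioc 0 x, g t =
      ∫⁻ t in Set.Ioi (0 : ℝ), g t * ∫⁻ x in Set.Ioi t, c x := by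
  have hm : Measurable fun z : ℝ × ℝ ↦
      {z : ℝ × ℝ | z.2 ≤ z.1}.indicator (fun z ↦ c z.1 * g z.2) z :=
    ((hc.comp measurable_fst).mul (hg.comp measurable_snd)).indicator
      (measurableSet_le measurable_snd measurable_fst)
  calc
    _ = ∫⁻ x in Set.Ioi (0 : ℝ), ∫⁻ t in Set.Ioi (0 : ℝ),
          {z : ℝ × ℝ | z.2 ≤ z.1}.indicator (fun z ↦ c z.1 * g z.2) (x, t) := by
      refine lintegral_congr fun x ↦ ?_
      rw [← lintegral_const_mul _ hg, ← Set.Ioi_inter_Iic, Set.inter_comm,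
        ← Measure.restrict_restrict measurableSet_Iic, ← lintegral_indicator measurableSet_Iic]
      rfl
    _ = ∫⁻ t in Set.Ioi (0 : ℝ), ∫⁻ x in Set.Ioi (0 : ℝ),
          {z : ℝ × ℝ | z.2 ≤ z.1}.indicator (fun z ↦ c z.1 * g z.2) (x, t) :=
      lintegral_lintegral_swap hm.aemeasurable
    _ = _ := by
      refine setLIntegral_congr_fun measurableSet_Ioi fun t ht ↦ ?_
      have hsub : Set.Ici t ∩ Set.Ioi 0 = Set.Ici t :=
        Set.inter_eq_left.2 fun x hx ↦ Set.mem_Ioi.2 (lt_of_lt_of_le ht hx)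
      simp only [← lintegral_const_mul _ hc]
      rw [setLIntegral_congr (Ioi_ae_eq_Ici (a := t)), ← hsub,
        ← Measure.restrict_restrict measurableSet_Ici, ← lintegral_indicator measurableSet_Ici]
      refine lintegral_congr fun x ↦ ?_
      by_cases h : t ≤ x <;> simp [Set.indicator, h, mul_comm]

theorem average_rpow_le {p : ℝ} (hp : 1 < p) {F : ℝ → ENNReal} (hF : Measurable F) {x : ℝ}
    (hx : 0 < x) :
    (ENNReal.ofReal x⁻¹ * ∫⁻ t in Set.Ioc 0 x, F t) ^ p ≤
      ENNReal.ofReal ((p / (p - 1)) ^ (p - 1)) * (ENNReal.ofReal (x ^ (-1 - (p - 1) / p)) *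
        ∫⁻ t in Set.Ioc 0 x, F t ^ p * ENNReal.ofReal (t ^ ((p - 1) / p))) := by
  have hp0 : 0 < p := by linarith
  have hp1 : 0 < p - 1 := by linarith
  set r := (p - 1) / p with hr
  have hr0 : 0 < r := div_pos hp1 hp0
  have hpq : p.HolderConjugate (p / (p - 1)) := Real.HolderConjugate.conjExponent hp
  have hholder := ENNReal.lintegral_mul_le_Lp_mul_Lq (volume.restrict (Set.Ioc 0 x)) hpq
    (f := fun t ↦ F t * ENNReal.ofReal (t ^ (r / p))) (g := fun t ↦ ENNReal.ofReal (t ^ (-(r / p))))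
    (by fun_prop) (by fun_prop)
  have h₁ : ∫⁻ t in Set.Ioc 0 x, ((fun t ↦ F t * ENNReal.ofReal (t ^ (r / p))) *
      fun t ↦ ENNReal.ofReal (t ^ (-(r / p)))) t = ∫⁻ t in Set.Ioc 0 x, F t := by
    refine setLIntegral_congr_fun measurableSet_Ioc fun t ht ↦ ?_
    simp only [Pi.mul_apply]
    rw [mul_assoc, ← ENNReal.ofReal_mul (Real.rpow_nonneg ht.1.le _), ← Real.rpow_add ht.1]
    simp
  have h₂ : ∫⁻ t in Set.Ioc 0 x, (F t * ENNReal.ofReal (t ^ (r / p))) ^ p =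
      ∫⁻ t in Set.Ioc 0 x, F t ^ p * ENNReal.ofReal (t ^ r) := by
    refine setLIntegral_congr_fun measurableSet_Ioc fun t ht ↦ ?_
    rw [ENNReal.mul_rpow_of_nonneg _ _ hp0.le,
      ENNReal.ofReal_rpow_of_nonneg (Real.rpow_nonneg ht.1.le _) hp0.le, ← Real.rpow_mul ht.1.le,
      div_mul_cancel₀ _ hp0.ne']
  have h₃ : ∫⁻ t in Set.Ioc 0 x, ENNReal.ofReal (t ^ (-(r / p))) ^ (p / (p - 1)) =
      ENNReal.ofReal (x ^ r / r) := by
    have hs : r - 1 + 1 = r := by ring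
    have := lintegral_Ioc_zero_rpow (s := r - 1) (by linarith) hx
    rw [hs] at this
    rw [← this]
    refine setLIntegral_congr_fun measurableSet_Ioc fun t ht ↦ ?_
    rw [ENNReal.ofReal_rpow_of_nonneg (Real.rpow_nonneg ht.1.le _) (div_pos hp0 hp1).le,
      ← Real.rpow_mul ht.1.le]
    congr 2
    rw [hr]
    field_simp
    ring
  rw [h₁, h₂, h₃] at hholder
  have hxr : 0 ≤ x ^ r / r := div_nonneg (Real.rpow_nonneg hx.le _) hr0.le
  have hconst : x⁻¹ ^ p * (x ^ r / r) ^ (p - 1) =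
      (p / (p - 1)) ^ (p - 1) * x ^ (-1 - r) := by
    have hrinv : p / (p - 1) = r⁻¹ := by rw [hr, inv_div]
    have hexp : -1 - r = -p + r * (p - 1) := by
      rw [hr]
      field_simp
      ring
    rw [hrinv, hexp, Real.rpow_add hx, Real.rpow_mul hx.le, Real.rpow_neg hx.le,
      Real.inv_rpow hx.le, div_eq_mul_inv,
      Real.mul_rpow (Real.rpow_nonneg hx.le _) (inv_nonneg.2 hr0.le)]
    ring
  calc
    _ ≤ (ENNReal.ofReal x⁻¹ * ((∫⁻ t in Set.Ioc 0 x, F t ^ p * ENNReal.ofReal (t ^ r)) ^ (1 / p) *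
          ENNReal.ofReal (x ^ r / r) ^ (1 / (p / (p - 1))))) ^ p := by gcongr
    _ = ENNReal.ofReal (x⁻¹ ^ p * (x ^ r / r) ^ (p - 1)) *
          ∫⁻ t in Set.Ioc 0 x, F t ^ p * ENNReal.ofReal (t ^ r) := by
      have hexp : 1 / (p / (p - 1)) * p = p - 1 := by field_simp
      rw [ENNReal.mul_rpow_of_nonneg _ _ hp0.le, ENNReal.mul_rpow_of_nonneg _ _ hp0.le,
        ← ENNReal.rpow_mul, ← ENNReal.rpow_mul, hexp, one_div_mul_cancel hp0.ne', ENNReal.rpow_one,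
        ENNReal.ofReal_rpow_of_nonneg (inv_nonneg.2 hx.le) hp0.le,
        ENNReal.ofReal_rpow_of_nonneg hxr hp1.le,
        ENNReal.ofReal_mul (Real.rpow_nonneg (inv_nonneg.2 hx.le) _)]
      ring
    _ = _ := by
      rw [hconst, ENNReal.ofReal_mul (Real.rpow_nonneg (div_pos hp0 hp1).le _), mul_assoc]

theorem lintegral_average_rpow_le {p : ℝ} (hp : 1 < p) {F : ℝ → ENNReal} (hF : Measurable F) :
    ∫⁻ x in Set.Ioi (0 : ℝ), (ENNReal.ofReal x⁻¹ * ∫⁻ t in Set.Ioc 0 x, F t) ^ p ≤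
      ENNReal.ofReal (p / (p - 1)) ^ p * ∫⁻ t in Set.Ioi (0 : ℝ), F t ^ p := by
  have hp0 : 0 < p := by linarith
  have hp1 : 0 < p - 1 := by linarith
  have hC : 0 < p / (p - 1) := div_pos hp0 hp1
  have hr0 : 0 < (p - 1) / p := div_pos hp1 hp0
  calc
    _ ≤ ∫⁻ x in Set.Ioi (0 : ℝ), ENNReal.ofReal ((p / (p - 1)) ^ (p - 1)) *
          (ENNReal.ofReal (x ^ (-1 - (p - 1) / p)) *
            ∫⁻ t in Set.Ioc 0 x, F t ^ p * ENNReal.ofReal (t ^ ((p - 1) / p))) :=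
      setLIntegral_mono' measurableSet_Ioi fun x hx ↦ average_rpow_le hp hF hx
    _ = ENNReal.ofReal ((p / (p - 1)) ^ (p - 1)) * ∫⁻ t in Set.Ioi (0 : ℝ),
          F t ^ p * ENNReal.ofReal (t ^ ((p - 1) / p)) *
            ∫⁻ x in Set.Ioi t, ENNReal.ofReal (x ^ (-1 - (p - 1) / p)) := by
      rw [lintegral_const_mul' _ _ ENNReal.ofReal_ne_top,
        lintegral_mul_lintegral_Ioc_swap (by fun_prop) (by fun_prop)]
    _ = ENNReal.ofReal ((p / (p - 1)) ^ (p - 1)) * ∫⁻ t in Set.Ioi (0 : ℝ),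
          ENNReal.ofReal (p / (p - 1)) * F t ^ p := by
      congr 1
      refine setLIntegral_congr_fun measurableSet_Ioi fun t (ht : 0 < t) ↦ ?_
      have hexp : -1 - (p - 1) / p + 1 = -((p - 1) / p) := by ring
      rw [lintegral_Ioi_rpow (by linarith) ht, hexp, mul_assoc,
        ← ENNReal.ofReal_mul (Real.rpow_nonneg ht.le _), neg_div_neg_eq, ← mul_div_assoc,
        ← Real.rpow_add ht, add_neg_cancel, Real.rpow_zero, one_div_div, mul_comm]
    _ = _ := by
      rw [lintegral_const_mul' _ _ ENNReal.ofReal_ne_top, ← mul_assoc,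
        ← ENNReal.ofReal_mul (Real.rpow_nonneg hC.le _), ← Real.rpow_add_one hC.ne',
        sub_add_cancel, ENNReal.ofReal_rpow_of_nonneg hC.le hp0.le]

/-- **Hardy's inequality** on `Lᵖ(0, ∞)`. -/
theorem eLpNorm_hardyOp1_le {p : ℝ} (hp : 1 < p) {f : ℝ → ℝ} (hf : Measurable f) :
    eLpNorm (hardyOp1 f) (ENNReal.ofReal p) (volume.restrict (Set.Ioi (0:ℝ))) ≤
      ENNReal.ofReal (p / (p - 1)) *
        eLpNorm f (ENNReal.ofReal p) (volume.restrict (Set.Ioi (0:ℝ))) := by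
  have hp0 : 0 < p := by linarith
  have hne : ENNReal.ofReal p ≠ 0 := (ENNReal.ofReal_pos.2 hp0).ne'
  rw [eLpNorm_eq_lintegral_rpow_enorm_toReal hne ENNReal.ofReal_ne_top,
    eLpNorm_eq_lintegral_rpow_enorm_toReal hne ENNReal.ofReal_ne_top, ENNReal.toReal_ofReal hp0.le]
  calc
    _ ≤ (ENNReal.ofReal (p / (p - 1)) ^ p *
          ∫⁻ t in Set.Ioi (0 : ℝ), ‖f t‖ₑ ^ p) ^ (1 / p) := by
      refine ENNReal.rpow_le_rpow (le_trans ?_ (lintegral_average_rpow_le hp hf.enorm))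
        (one_div_pos.2 hp0).le
      refine setLIntegral_mono' measurableSet_Ioi fun x hx ↦ ?_
      exact ENNReal.rpow_le_rpow (enorm_hardyOp1_le f hx) hp0.le
    _ = _ := by
      rw [ENNReal.mul_rpow_of_nonneg _ _ (one_div_pos.2 hp0).le, ← ENNReal.rpow_mul,
        mul_one_div_cancel hp0.ne', ENNReal.rpow_one]

/-- The power `x ^ (-s)` truncated to `(0, 1]`, an almost extremal function for Hardy's inequality
as `s` increases to `1 / p`. -/
noncomputable def truncatedPower (s : ℝ) : ℝ → ℝ :=
  (Set.Ioc 0 1).indicator fun x ↦ x ^ (-s)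

theorem measurable_truncatedPower (s : ℝ) : Measurable (truncatedPower s) :=
  Measurable.indicator (by fun_prop) measurableSet_Ioc

theorem truncatedPower_nonneg (s x : ℝ) : 0 ≤ truncatedPower s x := by
  refine Set.indicator_nonneg (fun t ht ↦ ?_) x
  exact Real.rpow_nonneg ht.1.le _

theorem hardyOp1_truncatedPower {s x : ℝ} (hs : s < 1) (hx : x ∈ Set.Ioc (0 : ℝ) 1) :
    hardyOp1 (truncatedPower s) x = (1 - s)⁻¹ * truncatedPower s x := by
  have hcongr : ∫ t in (0:ℝ)..x, truncatedPower s t = ∫ t in (0:ℝ)..x, t ^ (-s) := by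
    rw [intervalIntegral.integral_of_le hx.1.le, intervalIntegral.integral_of_le hx.1.le]
    refine setIntegral_congr_fun measurableSet_Ioc fun t ht ↦ ?_
    rw [truncatedPower, Set.indicator_of_mem (Set.mem_Ioc.2 ⟨ht.1, ht.2.trans hx.2⟩)]
  rw [hardyOp1, hcongr, integral_rpow (Or.inl (by linarith)), Real.zero_rpow (by linarith),
    truncatedPower, Set.indicator_of_mem hx, Real.rpow_add_one hx.1.ne', sub_zero]
  have := hx.1.ne'
  field_simp
  ring

theorem eLpNorm_truncatedPower {p s : ℝ} (hp : 0 < p) (hs : s * p < 1) :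
    eLpNorm (truncatedPower s) (ENNReal.ofReal p) (volume.restrict (Set.Ioi (0:ℝ))) =
      ENNReal.ofReal (1 / (1 - s * p)) ^ (1 / p) := by
  rw [eLpNorm_eq_lintegral_rpow_enorm_toReal (ENNReal.ofReal_pos.2 hp).ne' ENNReal.ofReal_ne_top,
    ENNReal.toReal_ofReal hp.le]
  congr 1
  have hint := lintegral_Ioc_zero_rpow (s := -(s * p)) (by linarith) one_pos
  rw [Real.one_rpow, neg_add_eq_sub] at hint
  have hsub : Set.Ioc (0 : ℝ) 1 ∩ Set.Ioi 0 = Set.Ioc 0 1 :=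
    Set.inter_eq_left.2 Set.Ioc_subset_Ioi_self
  rw [← hint, ← hsub, ← Measure.restrict_restrict measurableSet_Ioc,
    ← lintegral_indicator measurableSet_Ioc]
  refine lintegral_congr fun x ↦ ?_
  by_cases hx : x ∈ Set.Ioc (0 : ℝ) 1
  · rw [truncatedPower, Set.indicator_of_mem hx, Set.indicator_of_mem hx,
      Real.enorm_of_nonneg (Real.rpow_nonneg hx.1.le _),
      ENNReal.ofReal_rpow_of_nonneg (Real.rpow_nonneg hx.1.le _) hp.le, ← Real.rpow_mul hx.1.le,
      neg_mul]
  · rw [truncatedPower, Set.indicator_of_notMem hx, Set.indicator_of_notMem hx, enorm_zero,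
      ENNReal.zero_rpow_of_pos hp]

theorem le_eLpNorm_hardyOp1_truncatedPower {s : ℝ} (q : ENNReal) (hs : s < 1) :
    ENNReal.ofReal (1 - s)⁻¹ * eLpNorm (truncatedPower s) q (volume.restrict (Set.Ioi (0:ℝ))) ≤
      eLpNorm (hardyOp1 (truncatedPower s)) q (volume.restrict (Set.Ioi (0:ℝ))) := by
  rw [← Real.enorm_of_nonneg (inv_nonneg.2 (sub_pos.2 hs).le), ← eLpNorm_const_smul]
  refine eLpNorm_mono fun x ↦ ?_
  by_cases hx : x ∈ Set.Ioc (0 : ℝ) 1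
  · rw [hardyOp1_truncatedPower hs hx, Pi.smul_apply, smul_eq_mul]
  · simp [truncatedPower, hx]

theorem inv_one_sub_le_of_hardy_bound {p s C : ℝ} (hp : 1 < p) (hs : s * p < 1) (hs₁ : s < 1)
    (hC : 0 ≤ C) (h : ∀ f : ℝ → ℝ, Measurable f → (∀ x, 0 ≤ f x) →
        eLpNorm (hardyOp1 f) (ENNReal.ofReal p) (volume.restrict (Set.Ioi (0:ℝ))) ≤
          ENNReal.ofReal C * eLpNorm f (ENNReal.ofReal p) (volume.restrict (Set.Ioi (0:ℝ)))) :
    (1 - s)⁻¹ ≤ C := by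
  have hp0 : 0 < p := by linarith
  have hle := (le_eLpNorm_hardyOp1_truncatedPower (ENNReal.ofReal p) hs₁).trans
    (h _ (measurable_truncatedPower s) (truncatedPower_nonneg s))
  have hpos : 0 < ENNReal.ofReal (1 / (1 - s * p)) :=
    ENNReal.ofReal_pos.2 (one_div_pos.2 (sub_pos.2 hs))
  rw [eLpNorm_truncatedPower hp0 hs, ENNReal.mul_le_mul_iff_left
    (ENNReal.rpow_pos hpos ENNReal.ofReal_ne_top).ne'
    (ENNReal.rpow_ne_top_of_nonneg (one_div_pos.2 hp0).le ENNReal.ofReal_ne_top)] at hle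
  exact (ENNReal.ofReal_le_ofReal_iff hC).1 hle

/-- Sharpness of the constant `p/(p-1)` in Hardy's inequality: on nonnegative
measurable functions on `(0,∞)`, `p/(p-1)` is the least constant `C ≥ 0` such that
`‖Hf‖_{Lᵖ(0,∞)} ≤ C ‖f‖_{Lᵖ(0,∞)}`; i.e. the operator norm of `H` on `Lᵖ(0,∞)`
equals `p/(p-1)`. -/
theorem hardy_operator_norm_sharp (p : ℝ) (hp : 1 < p) :
    IsLeast {C : ℝ | 0 ≤ C ∧ ∀ f : ℝ → ℝ, Measurable f → (∀ x, 0 ≤ f x) →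
        eLpNorm (hardyOp1 f) (ENNReal.ofReal p) (volume.restrict (Set.Ioi (0:ℝ))) ≤
          ENNReal.ofReal C * eLpNorm f (ENNReal.ofReal p) (volume.restrict (Set.Ioi (0:ℝ)))}
      (p / (p - 1)) := by
  have hp0 : 0 < p := by linarith
  have hp1 : 0 < p - 1 := by linarith
  refine ⟨⟨(div_pos hp0 hp1).le, fun f hf _ ↦ eLpNorm_hardyOp1_le hp hf⟩, ?_⟩
  rintro C ⟨hC, h⟩
  have hlim : p / (p - 1) = (1 - 1 / p)⁻¹ := by field_simp
  have hlt : 1 / p < 1 := by rwa [div_lt_one hp0]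
  have hcont : ContinuousAt (fun s : ℝ ↦ (1 - s)⁻¹) (1 / p) :=
    (continuousAt_const.sub continuousAt_id).inv₀ (sub_pos.2 hlt).ne'
  rw [hlim]
  refine le_of_tendsto (hcont.tendsto.mono_left nhdsWithin_le_nhds :
    Filter.Tendsto _ (nhdsWithin (1 / p) (Set.Iio (1 / p))) _) ?_
  filter_upwards [self_mem_nhdsWithin] with s hs
  exact inv_one_sub_le_of_hardy_bound hp ((lt_div_iff₀ hp0).1 hs) (lt_trans hs hlt) hC h
end

section
/- For 1 < p < ∞, the Hardy operator ℋ maps the Herz-type Hardy space HK_p(ℝⁿ) boundedly to the Herz space K_p(ℝⁿ): there is C (depending only on n, p) with ‖ℋf‖_{K_p} ≤ C‖f‖_{HK_p}. -/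
open MeasureTheory Metric

/-- Volume of the ball of radius `r` in `ℝⁿ`. -/
noncomputable def ballVol (n : ℕ) (r : ℝ) : ℝ :=
  (volume (ball (0 : EuclideanSpace ℝ (Fin n)) r)).toReal

/-- The `n`-dimensional Hardy operator
`ℋf(x) = (1/(vₙ |x|ⁿ)) ∫_{|y| < |x|} f(y) dy`. -/
noncomputable def hardyOp (n : ℕ) (f : EuclideanSpace ℝ (Fin n) → ℝ)
    (x : EuclideanSpace ℝ (Fin n)) : ℝ :=
  (ballVol n 1 * ‖x‖ ^ n)⁻¹ * ∫ y in ball (0 : EuclideanSpace ℝ (Fin n)) ‖x‖, f y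

/-- The dyadic annulus `C_k = {x : 2^(k-1) < |x| ≤ 2^k}`. -/
def dyadicAnnulus (n : ℕ) (k : ℤ) : Set (EuclideanSpace ℝ (Fin n)) :=
  {x | (2 : ℝ) ^ (k - 1) < ‖x‖ ∧ ‖x‖ ≤ (2 : ℝ) ^ k}

/-- The Herz space norm `‖f‖_{K_p} = Σ_{k∈ℤ} 2^{kn/p'} ‖f·χ_{C_k}‖_{Lᵖ}`,
where `p' = p/(p-1)` is the conjugate exponent. -/
noncomputable def herzNorm (n : ℕ) (p : ℝ) (f : EuclideanSpace ℝ (Fin n) → ℝ) : ENNReal :=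
  ∑' k : ℤ, ENNReal.ofReal ((2 : ℝ) ^ (((k : ℝ) * n) / (p / (p - 1)))) *
    eLpNorm ((dyadicAnnulus n k).indicator f) (ENNReal.ofReal p) volume

/-- A central `(1,p)`-atom: supported in a ball `B(0,r)`, with
`‖a‖_{Lᵖ} ≤ |B(0,r)|^{1/p-1}` and vanishing integral. -/
def IsCentralAtom (n : ℕ) (p : ℝ) (a : EuclideanSpace ℝ (Fin n) → ℝ) : Prop :=
  ∃ r : ℝ, 0 < r ∧ Measurable a ∧
    (∀ x, x ∉ ball (0 : EuclideanSpace ℝ (Fin n)) r → a x = 0) ∧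
    eLpNorm a (ENNReal.ofReal p) volume ≤
      ENNReal.ofReal (((volume (ball (0 : EuclideanSpace ℝ (Fin n)) r)).toReal) ^
        (1 / p - 1)) ∧
    (∫ x, a x) = 0

theorem ballVol_one_pos (n : ℕ) : 0 < ballVol n 1 :=
  ENNReal.toReal_pos (measure_ball_pos _ _ one_pos).ne' measure_ball_lt_top.ne

theorem ballVol_eq_mul_pow {n : ℕ} (hn : 0 < n) {r : ℝ} (hr : 0 ≤ r) :
    ballVol n r = ballVol n 1 * r ^ n := by
  have : Nonempty (Fin n) := ⟨⟨0, hn⟩⟩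
  rw [ballVol, Measure.addHaar_ball _ _ hr, ENNReal.toReal_mul,
    ENNReal.toReal_ofReal (by positivity), finrank_euclideanSpace_fin, mul_comm, ← ballVol]

theorem ballVol_pos {n : ℕ} {r : ℝ} (hr : 0 < r) : 0 < ballVol n r :=
  ENNReal.toReal_pos (measure_ball_pos _ _ hr).ne' measure_ball_lt_top.ne

theorem ofReal_ballVol (n : ℕ) (r : ℝ) :
    ENNReal.ofReal (ballVol n r) = volume (ball (0 : EuclideanSpace ℝ (Fin n)) r) :=
  ENNReal.ofReal_toReal measure_ball_lt_top.ne

/-- Hölder's inequality on a centred ball. -/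
theorem setLIntegral_ball_enorm_le {n : ℕ} {p : ℝ} (hp : 1 < p)
    {a : EuclideanSpace ℝ (Fin n) → ℝ} (ha : Measurable a) {B : ℝ}
    (hB : eLpNorm a (ENNReal.ofReal p) volume ≤ ENNReal.ofReal B) {ρ : ℝ} (hρ : 0 < ρ) :
    ∫⁻ y in ball (0 : EuclideanSpace ℝ (Fin n)) ρ, ‖a y‖ₑ ≤
      ENNReal.ofReal (B * ballVol n ρ ^ (1 - 1 / p)) := by
  rw [← eLpNorm_one_eq_lintegral_enorm]
  refine (eLpNorm_le_eLpNorm_mul_rpow_measure_univ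
    (q := ENNReal.ofReal p) (by simpa using hp.le) ha.aestronglyMeasurable).trans ?_
  rw [Measure.restrict_apply_univ, ← ofReal_ballVol, ENNReal.toReal_ofReal (by linarith),
    ENNReal.toReal_one, div_one, ENNReal.ofReal_rpow_of_pos (ballVol_pos hρ),
    ENNReal.ofReal_mul' (Real.rpow_nonneg (ballVol_pos hρ).le _)]
  gcongr
  exact (eLpNorm_restrict_le _ _ _ _).trans hB

theorem IsCentralAtom.lintegral_enorm_le_one {n : ℕ} {p : ℝ} (hp : 1 < p)
    {a : EuclideanSpace ℝ (Fin n) → ℝ} (ha : IsCentralAtom n p a) :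
    ∫⁻ y, ‖a y‖ₑ ≤ 1 := by
  obtain ⟨r, hr, hm, hsupp, hnorm, -⟩ := ha
  rw [← setLIntegral_eq_of_support_subset (s := ball 0 r)]
  · refine (setLIntegral_ball_enorm_le hp hm hnorm hr).trans ?_
    rw [← ballVol, ← Real.rpow_add (ballVol_pos hr)]
    simp
  · intro x hx
    by_contra hxr
    simp [hsupp x hxr] at hx

/-- Pointwise bound on an annulus for the Hardy operator applied to a central atom. -/
theorem IsCentralAtom.exists_enorm_hardyOp_le {n : ℕ} (hn : 0 < n) {p : ℝ} (hp : 1 < p)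
    {a : EuclideanSpace ℝ (Fin n) → ℝ} (ha : IsCentralAtom n p a) :
    ∃ r : ℝ, 0 < r ∧ ∀ (k : ℤ), ∀ x ∈ dyadicAnnulus n k,
      ‖hardyOp n a x‖ₑ ≤ ENNReal.ofReal (if (2 : ℝ) ^ (k - 1) < r then
        ballVol n ((2 : ℝ) ^ (k - 1)) ^ (-(1 / p)) * ballVol n r ^ (1 / p - 1) else 0) := by
  obtain ⟨r, hr, hm, hsupp, hnorm, hint⟩ := ha
  refine ⟨r, hr, fun k x hx => ?_⟩
  have h2 : (0 : ℝ) < (2 : ℝ) ^ (k - 1) := by positivity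
  have hx0 : 0 < ‖x‖ := h2.trans hx.1
  rcases le_or_gt r ‖x‖ with hrx | hrx
  · have h0 : ∫ y in ball (0 : EuclideanSpace ℝ (Fin n)) ‖x‖, a y = 0 := by
      rw [setIntegral_eq_integral_of_forall_compl_eq_zero, hint]
      exact fun y hy => hsupp y fun h => hy (ball_subset_ball hrx h)
    simp [hardyOp, h0]
  · rw [if_pos (hx.1.trans hrx), hardyOp, ← ballVol_eq_mul_pow hn hx0.le, enorm_mul]
    have hV := ballVol_pos (n := n) hx0
    have hVr := ballVol_pos (n := n) hr
    have hVk := ballVol_pos (n := n) h2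
    calc _ ≤ ENNReal.ofReal (ballVol n ‖x‖)⁻¹ *
          ENNReal.ofReal (ballVol n r ^ (1 / p - 1) * ballVol n ‖x‖ ^ (1 - 1 / p)) := by
          rw [Real.enorm_of_nonneg (inv_nonneg.2 hV.le)]
          gcongr
          exact (enorm_integral_le_lintegral_enorm _).trans
            (setLIntegral_ball_enorm_le hp hm hnorm hx0)
      _ = ENNReal.ofReal (ballVol n ‖x‖ ^ (-(1 / p)) * ballVol n r ^ (1 / p - 1)) := by
          rw [← ENNReal.ofReal_mul (inv_nonneg.2 hV.le)]
          congr 1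
          rw [show -(1 / p) = -1 + (1 - 1 / p) by ring, Real.rpow_add hV, Real.rpow_neg_one]
          ring
      _ ≤ _ := by
          gcongr 2
          refine Real.rpow_le_rpow_of_nonpos hVk ?_ (by simp; linarith)
          rw [ballVol_eq_mul_pow hn h2.le, ballVol_eq_mul_pow hn hx0.le]
          have := ballVol_one_pos n
          have := hx.1
          gcongr

theorem eLpNorm_indicator_dyadicAnnulus_le {n : ℕ} (hn : 0 < n) {p : ℝ} (hp : 1 < p) {k : ℤ}
    {g : EuclideanSpace ℝ (Fin n) → ℝ} {c : ENNReal}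
    (hg : ∀ x ∈ dyadicAnnulus n k, ‖g x‖ₑ ≤ c) :
    eLpNorm ((dyadicAnnulus n k).indicator g) (ENNReal.ofReal p) volume ≤
      c * ENNReal.ofReal (ballVol n ((2 : ℝ) ^ k) ^ (1 / p)) := by
  calc _ ≤ eLpNorm ((dyadicAnnulus n k).indicator fun _ => c) (ENNReal.ofReal p) volume := by
        refine eLpNorm_mono_enorm fun x => ?_
        by_cases hx : x ∈ dyadicAnnulus n k
        · simpa [hx] using hg x hx
        · simp [hx]
    _ ≤ c * volume (dyadicAnnulus n k) ^ (1 / p) := by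
        have := eLpNorm_indicator_const_le (μ := volume) (s := dyadicAnnulus n k) c
          (ENNReal.ofReal p)
        rwa [ENNReal.toReal_ofReal (by linarith)] at this
    _ ≤ _ := by
        rw [← ENNReal.ofReal_rpow_of_pos (ballVol_pos (by positivity)), ofReal_ballVol]
        have : Nonempty (Fin n) := ⟨⟨0, hn⟩⟩
        rw [← Measure.addHaar_closedBall_eq_addHaar_ball]
        gcongr
        exact fun x hx => by simpa using hx.2

/-- The terms of the Herz series of an atom are dominated by a geometric progression. -/
theorem herz_term_le {n : ℕ} (hn : 0 < n) {p : ℝ} (hp : 1 < p) {r : ℝ} {m : ℤ}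
    (hm : (2 : ℝ) ^ m < r) (i : ℕ) :
    (2 : ℝ) ^ ((((m + 1 - i : ℤ) : ℝ) * n) / (p / (p - 1))) *
      ((ballVol n ((2 : ℝ) ^ (m + 1 - i - 1)) ^ (-(1 / p)) * ballVol n r ^ (1 / p - 1)) *
        ballVol n ((2 : ℝ) ^ (m + 1 - i : ℤ)) ^ (1 / p)) ≤
      ballVol n 1 ^ (1 / p - 1) * 2 ^ (n / p + n * (1 - 1 / p)) *
        ((2 : ℝ) ^ (-(n * (1 - 1 / p)))) ^ i := by
  have hv := ballVol_one_pos n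
  have hV (l : ℤ) (t : ℝ) :
      ballVol n ((2 : ℝ) ^ l) ^ t = ballVol n 1 ^ t * (2 : ℝ) ^ ((l : ℝ) * n * t) := by
    rw [ballVol_eq_mul_pow hn (by positivity), Real.mul_rpow hv.le (by positivity),
      ← Real.rpow_intCast, ← Real.rpow_natCast, ← Real.rpow_mul (by positivity),
      ← Real.rpow_mul (by norm_num), mul_assoc (l : ℝ)]
  have hr : ballVol n r ^ (1 / p - 1) ≤ ballVol n ((2 : ℝ) ^ m) ^ (1 / p - 1) := by
    have h2 : (0 : ℝ) < 2 ^ m := by positivity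
    refine Real.rpow_le_rpow_of_nonpos (ballVol_pos h2) ?_ ?_
    · rw [ballVol_eq_mul_pow hn h2.le, ballVol_eq_mul_pow hn (h2.trans hm).le]
      gcongr
    · rw [sub_nonpos, div_le_one (by linarith)]
      exact hp.le
  have hk := (ballVol_pos (n := n) (r := (2 : ℝ) ^ (m + 1 - i - 1)) (by positivity)).le
  have hk' := (ballVol_pos (n := n) (r := (2 : ℝ) ^ (m + 1 - i)) (by positivity)).le
  refine (mul_le_mul_of_nonneg_left (mul_le_mul_of_nonneg_right
    (mul_le_mul_of_nonneg_left hr (by positivity)) (by positivity)) (by positivity)).trans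
    (le_of_eq ?_)
  rw [hV, hV, hV, ← Real.rpow_natCast (_ ^ _) i, ← Real.rpow_mul (by norm_num)]
  have e : ballVol n 1 ^ (-(1 / p)) * ballVol n 1 ^ (1 / p) = 1 := by
    rw [← Real.rpow_add hv]; simp
  have hp0 : p ≠ 0 := by linarith
  calc _ = (ballVol n 1 ^ (-(1 / p)) * ballVol n 1 ^ (1 / p)) * ballVol n 1 ^ (1 / p - 1) *
        ((2 : ℝ) ^ ((((m + 1 - i : ℤ) : ℝ) * n) / (p / (p - 1))) *
        (2 : ℝ) ^ (((m + 1 - i - 1 : ℤ) : ℝ) * n * (-(1 / p))) *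
        (2 : ℝ) ^ ((m : ℝ) * n * (1 / p - 1)) *
        (2 : ℝ) ^ (((m + 1 - i : ℤ) : ℝ) * n * (1 / p))) := by ring
    _ = _ := by
      rw [e, one_mul, mul_assoc (ballVol n 1 ^ (1 / p - 1))]
      congr 1
      simp only [← Real.rpow_add (show (0 : ℝ) < 2 by norm_num)]
      congr 1
      push_cast
      field_simp
      ring

theorem exists_tsum_herz_term_le {n : ℕ} (hn : 0 < n) {p : ℝ} (hp : 1 < p) :
    ∃ K : ENNReal, K ≠ ⊤ ∧ ∀ r : ℝ, 0 < r →
      ∑' k : ℤ, ENNReal.ofReal ((2 : ℝ) ^ (((k : ℝ) * n) / (p / (p - 1)))) *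
        (ENNReal.ofReal (if (2 : ℝ) ^ (k - 1) < r then
          ballVol n ((2 : ℝ) ^ (k - 1)) ^ (-(1 / p)) * ballVol n r ^ (1 / p - 1) else 0) *
          ENNReal.ofReal (ballVol n ((2 : ℝ) ^ k) ^ (1 / p))) ≤ K := by
  set s : ℝ := n * (1 - 1 / p) with hs
  have hs0 : 0 < s := by
    have : 1 / p < 1 := by rw [div_lt_one] <;> linarith
    have : (0 : ℝ) < n := by exact_mod_cast hn
    have : 0 < 1 - 1 / p := by linarith
    positivity
  set q : ENNReal := ENNReal.ofReal ((2 : ℝ) ^ (-s)) with hq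
  have hq1 : q < 1 := by
    rw [hq, ENNReal.ofReal_lt_one]
    exact Real.rpow_lt_one_of_one_lt_of_neg (by norm_num) (by linarith)
  refine ⟨ENNReal.ofReal (ballVol n 1 ^ (1 / p - 1) * 2 ^ (n / p + s)) * (1 - q)⁻¹,
    ENNReal.mul_ne_top ENNReal.ofReal_ne_top
      (ENNReal.inv_ne_top.2 (tsub_pos_of_lt hq1).ne'), fun r hr => ?_⟩
  obtain ⟨m, hm, hm'⟩ := exists_mem_Ioc_zpow hr (one_lt_two (α := ℝ))
  have hinj : Function.Injective fun i : ℕ => m + 1 - (i : ℤ) := fun i j h => by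
    simpa using h
  rw [← hinj.tsum_eq, ← ENNReal.tsum_geometric, ← ENNReal.tsum_mul_left]
  · refine ENNReal.tsum_le_tsum fun i => ?_
    have h2 : (2 : ℝ) ^ (m + 1 - i - 1 : ℤ) < r :=
      (zpow_le_zpow_right₀ one_le_two (by omega)).trans_lt hm
    have hv := ballVol_one_pos n
    have h3 := (ballVol_pos (n := n) (r := (2 : ℝ) ^ (m + 1 - i - 1)) (by positivity)).le
    have h4 := (ballVol_pos (n := n) hr).le
    rw [if_pos h2, hq, ← ENNReal.ofReal_pow (by positivity),
      ← ENNReal.ofReal_mul (by positivity), ← ENNReal.ofReal_mul (by positivity),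
      ← ENNReal.ofReal_mul (by positivity)]
    exact ENNReal.ofReal_le_ofReal (herz_term_le hn hp hm i)
  · intro k hk
    by_contra hkr
    refine hk ?_
    have : m + 1 < k := by
      by_contra! h
      exact hkr ⟨(m + 1 - k).toNat, by simp only; omega⟩
    have : r ≤ (2 : ℝ) ^ (k - 1) :=
      hm'.trans (zpow_le_zpow_right₀ one_le_two (by omega))
    simp [this.not_gt]

/-- The Hardy operator may be applied term by term to an atomic series. -/
theorem enorm_hardyOp_tsum_le {n : ℕ} {p : ℝ} (hp : 1 < p) {lam : ℕ → ℝ}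
    {a : ℕ → EuclideanSpace ℝ (Fin n) → ℝ} (ha : ∀ j, IsCentralAtom n p (a j))
    (hlam : Summable fun j => |lam j|) (x : EuclideanSpace ℝ (Fin n)) :
    ‖hardyOp n (fun y => ∑' j, lam j * a j y) x‖ₑ ≤ ∑' j, ‖lam j‖ₑ * ‖hardyOp n (a j) x‖ₑ := by
  have hmeas (j : ℕ) : Measurable (a j) := by
    obtain ⟨r, hr, hm, -⟩ := ha j
    exact hm
  have hlam' : ∑' j, ‖lam j‖ₑ ≠ ⊤ := by
    simp_rw [← Real.enorm_abs (lam _), Real.enorm_of_nonneg (abs_nonneg (lam _))]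
    exact hlam.tsum_ofReal_ne_top
  rw [hardyOp, integral_tsum (fun j => ((hmeas j).const_mul _).aestronglyMeasurable),
    ← tsum_mul_left]
  · refine enorm_tsum_le_tsum_enorm.trans (ENNReal.tsum_le_tsum fun j => le_of_eq ?_)
    rw [integral_const_mul, ← enorm_mul, hardyOp]
    congr 1
    ring
  · refine ne_top_of_le_ne_top hlam' (ENNReal.tsum_le_tsum fun j => ?_)
    simp_rw [enorm_mul]
    rw [lintegral_const_mul _ (hmeas j).enorm]
    calc _ ≤ ‖lam j‖ₑ * 1 := by
          gcongr
          exact (setLIntegral_le_lintegral _ _).trans ((ha j).lintegral_enorm_le_one hp)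
      _ = _ := mul_one _

/-- The Hardy operator maps the Herz-type Hardy space `HK_p(ℝⁿ)` boundedly to the
Herz space `K_p(ℝⁿ)`: there is `C > 0` (depending only on `n, p`) such that for any
atomic decomposition `f = Σ λⱼ aⱼ` into central `(1,p)`-atoms with `Σ|λⱼ| < ∞`,
`‖ℋf‖_{K_p} ≤ C · Σ|λⱼ|`; hence `‖ℋf‖_{K_p} ≤ C ‖f‖_{HK_p}`. -/
theorem hardy_HKp_to_Kp (n : ℕ) (hn : 0 < n) (p : ℝ) (hp : 1 < p) :
    ∃ C : ℝ, 0 < C ∧ ∀ (f : EuclideanSpace ℝ (Fin n) → ℝ) (lam : ℕ → ℝ)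
      (a : ℕ → EuclideanSpace ℝ (Fin n) → ℝ),
      Integrable f volume → (∀ j, IsCentralAtom n p (a j)) →
      Summable (fun j => |lam j|) → (∀ x, f x = ∑' j, lam j * a j x) →
      herzNorm n p (hardyOp n f) ≤ ENNReal.ofReal (C * ∑' j, |lam j|) := by
  obtain ⟨K, hK, hsum⟩ := exists_tsum_herz_term_le hn hp
  refine ⟨K.toReal + 1, by positivity, fun f lam a _ ha hlam hf => ?_⟩
  obtain rfl : f = fun x => ∑' j, lam j * a j x := funext hf
  choose r hr hbound using fun j => (ha j).exists_enorm_hardyOp_le hn hp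
  calc _ ≤ ∑' k : ℤ, ENNReal.ofReal ((2 : ℝ) ^ (((k : ℝ) * n) / (p / (p - 1)))) *
        ((∑' j, ‖lam j‖ₑ * ENNReal.ofReal (if (2 : ℝ) ^ (k - 1) < r j then
          ballVol n ((2 : ℝ) ^ (k - 1)) ^ (-(1 / p)) * ballVol n (r j) ^ (1 / p - 1) else 0)) *
          ENNReal.ofReal (ballVol n ((2 : ℝ) ^ k) ^ (1 / p))) := by
        refine ENNReal.tsum_le_tsum fun k => mul_le_mul_right
          (eLpNorm_indicator_dyadicAnnulus_le hn hp fun x hx => ?_) _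
        refine (enorm_hardyOp_tsum_le hp ha hlam x).trans (ENNReal.tsum_le_tsum fun j => ?_)
        gcongr
        exact hbound j k x hx
    _ = ∑' j, ‖lam j‖ₑ *
        ∑' k : ℤ, ENNReal.ofReal ((2 : ℝ) ^ (((k : ℝ) * n) / (p / (p - 1)))) *
        (ENNReal.ofReal (if (2 : ℝ) ^ (k - 1) < r j then
          ballVol n ((2 : ℝ) ^ (k - 1)) ^ (-(1 / p)) * ballVol n (r j) ^ (1 / p - 1) else 0) *
          ENNReal.ofReal (ballVol n ((2 : ℝ) ^ k) ^ (1 / p))) := by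
        simp_rw [← ENNReal.tsum_mul_left, ← ENNReal.tsum_mul_right, ← ENNReal.tsum_mul_left]
        rw [ENNReal.tsum_comm]
        refine tsum_congr fun j => tsum_congr fun k => ?_
        ring
    _ ≤ ∑' j, ‖lam j‖ₑ * K := by
        gcongr with j
        exact hsum (r j) (hr j)
    _ ≤ _ := by
        rw [ENNReal.tsum_mul_right, mul_comm, ENNReal.ofReal_mul (by positivity),
          ENNReal.ofReal_tsum_of_nonneg (fun _ => abs_nonneg _) hlam]
        gcongr with j
        · rw [← ENNReal.ofReal_toReal hK]
          exact ENNReal.ofReal_le_ofReal (by simp)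
        · rw [← Real.enorm_abs, Real.enorm_of_nonneg (abs_nonneg _)]
end
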